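/- Suppose κᵖ(t) ≡ 1 and κᶜ(t) ≡ κᶜ with 0 < |κᶜ| < ν √γ_m, and let (u_d, u_e) be a solution of the one-driver one-evader system on [0,∞) with u_d(0) ≠ u_e(0) and u(t) := u_d(t) − u_e(t) ≠ 0 for all t. Then |u(t)| converges as t → ∞ to the constant r_c > 0 determined by f(r_c) = (κᶜ/ν)², and there exists a phase φ₁ ∈ [0,2π) such that u(t) − r_c (cos(κᶜ t/ν + φ₁), sin(κᶜ t/ν + φ₁)) → 0; moreover there exist a center u_c* ∈ ℝ², radii r_d, r_e ≥ 0, and phases φ_d, φ_e ∈ ℝ such that u_d(t) − (r_d (cos(κᶜ t/ν + φ_d), sin(κᶜ t/ν + φ_d)) + u_c*) → 0 and u_e(t) − (r_e (cos(κᶜ t/ν + φ_e), sin(κᶜ t/ν + φ_e)) + u_c*) → 0 as t → ∞; that is, the driver and evader converge to rotational circumvention motion with common angular velocity κᶜ/ν and common center. -/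

import Mathlib

open Real Filter MeasureTheory intervalIntegral
open scoped RealInnerProductSpace Topology

noncomputable section

/-- Perpendicular rotation in the plane: `(a, b)^⊥ = (-b, a)`. -/
def perp (w : EuclideanSpace ℝ (Fin 2)) : EuclideanSpace ℝ (Fin 2) :=
  (WithLp.equiv 2 (Fin 2 → ℝ)).symm ![-(w 1), w 0]

/-- The planar vector `r (cos θ, sin θ)`. -/
def circVec (r θ : ℝ) : EuclideanSpace ℝ (Fin 2) :=
  (WithLp.equiv 2 (Fin 2 → ℝ)).symm ![r * Real.cos θ, r * Real.sin θ]

/-- The one-driver one-evader guidance-by-repulsion system holds at time `t`: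
`u_d'' = −κᵖ(t) f_d(|u|) u + κᶜ(t) u^⊥ − ν u_d'` and
`u_e'' = −f_e(|u|) u − ν u_e'`, where `u = u_d − u_e`. -/
def SolvesSys (fd fe : ℝ → ℝ) (ν : ℝ) (κp κc : ℝ → ℝ)
    (ud ue : ℝ → EuclideanSpace ℝ (Fin 2)) (t : ℝ) : Prop :=
  deriv (deriv ud) t
      = -(κp t * fd ‖ud t - ue t‖) • (ud t - ue t)
        + κc t • perp (ud t - ue t) - ν • deriv ud t ∧
  deriv (deriv ue) t
      = -(fe ‖ud t - ue t‖) • (ud t - ue t) - ν • deriv ue t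

/-- Length of the range of values taken by `x` from time `s` on. -/
def futureRange (x : ℝ → ℝ) (s : ℝ) : ℝ := sSup (x '' Set.Ici s) - sInf (x '' Set.Ici s)

section FutureRange

variable {x : ℝ → ℝ} {R : ℝ}

theorem bddAbove_image_Ici (hbd : ∀ t, 0 ≤ t → |x t| ≤ R) {s : ℝ} (hs : 0 ≤ s) :
    BddAbove (x '' Set.Ici s) := by
  refine ⟨R, ?_⟩
  rintro _ ⟨t, ht, rfl⟩
  exact (abs_le.1 (hbd t (hs.trans ht))).2

theorem bddBelow_image_Ici (hbd : ∀ t, 0 ≤ t → |x t| ≤ R) {s : ℝ} (hs : 0 ≤ s) :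
    BddBelow (x '' Set.Ici s) := by
  refine ⟨-R, ?_⟩
  rintro _ ⟨t, ht, rfl⟩
  exact (abs_le.1 (hbd t (hs.trans ht))).1

theorem futureRange_nonneg (hbd : ∀ t, 0 ≤ t → |x t| ≤ R) {s : ℝ} (hs : 0 ≤ s) :
    0 ≤ futureRange x s := by
  have h1 := le_csSup (bddAbove_image_Ici hbd hs) ⟨s, Set.self_mem_Ici, rfl⟩
  have h2 := csInf_le (bddBelow_image_Ici hbd hs) ⟨s, Set.self_mem_Ici, rfl⟩
  unfold futureRange
  linarith

theorem futureRange_anti (hbd : ∀ t, 0 ≤ t → |x t| ≤ R) {s t : ℝ} (hs : 0 ≤ s) (hst : s ≤ t) :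
    futureRange x t ≤ futureRange x s := by
  have hsub : x '' Set.Ici t ⊆ x '' Set.Ici s := Set.image_mono (Set.Ici_subset_Ici.2 hst)
  have hne : (x '' Set.Ici t).Nonempty := ⟨x t, t, Set.self_mem_Ici, rfl⟩
  have h1 := csSup_le_csSup (bddAbove_image_Ici hbd hs) hne hsub
  have h2 := csInf_le_csInf (bddBelow_image_Ici hbd hs) hne hsub
  unfold futureRange
  linarith

/-- If after time `t` a continuous function stays at distance at least `b` from its value at
time `s ≤ t`, its future range shrinks by at least `b` between `s` and `t`. -/
theorem futureRange_add_le (hx : ContinuousOn x (Set.Ici 0)) (hbd : ∀ t, 0 ≤ t → |x t| ≤ R)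
    {s t b : ℝ} (hs : 0 ≤ s) (hst : s ≤ t) (hb : 0 < b)
    (hfar : ∀ r, t ≤ r → b ≤ |x s - x r|) :
    futureRange x t + b ≤ futureRange x s := by
  have hsub : x '' Set.Ici t ⊆ x '' Set.Ici s := Set.image_mono (Set.Ici_subset_Ici.2 hst)
  have hne : (x '' Set.Ici t).Nonempty := ⟨x t, t, Set.self_mem_Ici, rfl⟩
  have h1 := csSup_le_csSup (bddAbove_image_Ici hbd hs) hne hsub
  have h2 := csInf_le_csInf (bddBelow_image_Ici hbd hs) hne hsub
  have h3 := le_csSup (bddAbove_image_Ici hbd hs) ⟨s, Set.self_mem_Ici, rfl⟩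
  have h4 := csInf_le (bddBelow_image_Ici hbd hs) ⟨s, Set.self_mem_Ici, rfl⟩
  have hpre : IsPreconnected (x '' Set.Ici t) :=
    isPreconnected_Ici.image x (hx.mono (Set.Ici_subset_Ici.2 (hs.trans hst)))
  have hnot : x s ∉ x '' Set.Ici t := by
    rintro ⟨r, hr, hrx⟩
    have := hfar r hr
    rw [hrx, sub_self, abs_zero] at this
    linarith
  have hside : (∀ r, t ≤ r → x s + b ≤ x r) ∨ (∀ r, t ≤ r → x r ≤ x s - b) := by
    by_contra! hcon
    obtain ⟨⟨r, hr, hr'⟩, ⟨q, hq, hq'⟩⟩ := hcon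
    have hr2 : x r ≤ x s - b := by
      rcases le_abs.1 (hfar r hr) with h | h <;> linarith
    have hq2 : x s + b ≤ x q := by
      rcases le_abs.1 (hfar q hq) with h | h <;> linarith
    exact hnot (hpre.ordConnected.out ⟨r, hr, rfl⟩ ⟨q, hq, rfl⟩ ⟨by linarith, by linarith⟩)
  unfold futureRange
  rcases hside with h | h
  · have : x s + b ≤ sInf (x '' Set.Ici t) := le_csInf hne (by
      rintro _ ⟨r, hr, rfl⟩; exact h r hr)
    linarith
  · have : sSup (x '' Set.Ici t) ≤ x s - b := csSup_le hne (by
      rintro _ ⟨r, hr, rfl⟩; exact h r hr)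
    linarith

end FutureRange

theorem exists_sum_Ico_le {b : ℕ → ℝ} {x : ℝ → ℝ} {C R : ℝ} (hC : 1 ≤ C)
    (hb : ∀ n, 0 ≤ b n) (hstep : ∀ n, b (n + 1) ≤ C * b n)
    (hx : ContinuousOn x (Set.Ici 0)) (hbd : ∀ t, 0 ≤ t → |x t| ≤ R)
    (hE : ∀ n m : ℕ, n ≤ m → ∀ t : ℝ, (m : ℝ) ≤ t →
      ∑ j ∈ Finset.Ico n m, b j ^ 2 ≤ C * (b n ^ 2 + (x n - x t) ^ 2)) :
    ∃ A B : ℝ, 0 ≤ A ∧ 0 ≤ B ∧ ∀ n : ℕ, ∃ m : ℕ, n < m ∧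
      ∑ j ∈ Finset.Ico n m, b j ≤
        A * (futureRange x n - futureRange x m) + B * (b n - b m) := by
  have hC0 : 0 < C := by linarith
  have hC3 : 0 ≤ C ^ 3 := by positivity
  set D : ℝ := 2 * C + 2 * C ^ 3 with hD
  have hD0 : 0 ≤ D := by positivity
  refine ⟨2 * D + 4 * D * (2 * C ^ 3), 4 * D, by positivity, by positivity, fun n => ?_⟩
  have hanti : ∀ m : ℕ, n ≤ m → futureRange x m ≤ futureRange x n := fun m hm =>
    futureRange_anti hbd (Nat.cast_nonneg n) (Nat.cast_le.2 hm)
  rcases (hb n).eq_or_lt with h0 | hpos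
  · refine ⟨n + 1, Nat.lt_succ_self n, ?_⟩
    have h1 : b (n + 1) = 0 := le_antisymm (by simpa [← h0] using hstep n) (hb _)
    have h2 := hanti (n + 1) (Nat.le_succ n)
    simp only [Nat.Ico_succ_singleton, Finset.sum_singleton, ← h0, h1]
    have : 0 ≤ (2 * D + 4 * D * (2 * C ^ 3)) * (futureRange x n - futureRange x (n + 1 : ℕ)) :=
      mul_nonneg (by positivity) (by linarith)
    simpa using this
  let P : ℕ → Prop := fun m => n < m ∧
    (b m ≤ b n / 2 ∨ 2 * C * b n ^ 2 ≤ ∑ j ∈ Finset.Ico n m, b j ^ 2)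
  have hex : ∃ m, P m := by
    by_contra! hcon
    have hlow : ∀ m, n < m → b n / 2 < b m ∧ ∑ j ∈ Finset.Ico n m, b j ^ 2 < 2 * C * b n ^ 2 := by
      intro m hm
      have := hcon m
      simp only [P, not_and, not_or, not_le] at this
      exact this hm
    obtain ⟨N, hN⟩ := exists_nat_gt (8 * C)
    have h1 := (hlow (n + N + 1) (by omega)).2
    have h2 : ∑ j ∈ Finset.Ico n (n + N + 1), (b n / 2) ^ 2
        ≤ ∑ j ∈ Finset.Ico n (n + N + 1), b j ^ 2 := by
      refine Finset.sum_le_sum fun j hj => ?_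
      have hj' := Finset.mem_Ico.1 hj
      rcases hj'.1.eq_or_lt with rfl | hlt
      · exact pow_le_pow_left₀ (by linarith) (by linarith) 2
      · exact pow_le_pow_left₀ (by linarith) (hlow j hlt).1.le 2
    rw [Finset.sum_const, Nat.card_Ico, nsmul_eq_mul] at h2
    have h3 : ((n + N + 1 - n : ℕ) : ℝ) = N + 1 := by
      have : n + N + 1 - n = N + 1 := by omega
      rw [this]; push_cast; ring
    rw [h3] at h2
    have h4 : 0 < b n ^ 2 := by positivity
    nlinarith
  classical
  let m := Nat.find hex
  have hm : P m := Nat.find_spec hex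
  have hmin : ∀ j, n < j → j < m → b n / 2 < b j ∧
      ∑ i ∈ Finset.Ico n j, b i ^ 2 < 2 * C * b n ^ 2 := by
    intro j hj hjm
    have := Nat.find_min hex hjm
    simp only [P, not_and, not_or, not_le] at this
    exact this hj
  obtain ⟨k, hk⟩ : ∃ k, m = k + 1 := ⟨m - 1, by have := hm.1; omega⟩
  have hnk : n ≤ k := by have := hm.1; omega
  have hkb : b k ^ 2 ≤ 2 * C ^ 3 * b n ^ 2 ∧
      ∑ j ∈ Finset.Ico n k, b j ^ 2 ≤ 2 * C * b n ^ 2 := by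
    rcases hnk.eq_or_lt with rfl | hlt
    · refine ⟨?_, by simp; positivity⟩
      have : 1 ≤ C ^ 3 := one_le_pow₀ hC
      nlinarith [sq_nonneg (b n)]
    · have h1 := (hmin k hlt (by omega)).2
      refine ⟨?_, h1.le⟩
      obtain ⟨i, rfl⟩ : ∃ i, k = i + 1 := ⟨k - 1, by omega⟩
      have h2 : b i ^ 2 ≤ ∑ j ∈ Finset.Ico n (i + 1), b j ^ 2 :=
        Finset.single_le_sum (f := fun j => b j ^ 2) (fun _ _ => sq_nonneg _)
          (Finset.mem_Ico.2 ⟨by omega, by omega⟩)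
      have h3 : b (i + 1) ^ 2 ≤ (C * b i) ^ 2 := pow_le_pow_left₀ (hb _) (hstep i) 2
      have h4 : C ^ 2 * b i ^ 2 ≤ C ^ 2 * (2 * C * b n ^ 2) :=
        mul_le_mul_of_nonneg_left (by linarith) (by positivity)
      calc b (i + 1) ^ 2 ≤ (C * b i) ^ 2 := h3
        _ = C ^ 2 * b i ^ 2 := by ring
        _ ≤ C ^ 2 * (2 * C * b n ^ 2) := h4
        _ = 2 * C ^ 3 * b n ^ 2 := by ring
  have hsq : ∑ j ∈ Finset.Ico n m, b j ^ 2 ≤ D * b n ^ 2 := by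
    rw [hk, Finset.sum_Ico_succ_top hnk, hD]
    linarith [hkb.1, hkb.2]
  have hsum : ∑ j ∈ Finset.Ico n m, b j ≤ 2 * D * b n := by
    have h1 : (∑ j ∈ Finset.Ico n m, b j) * (b n / 2) ≤ ∑ j ∈ Finset.Ico n m, b j ^ 2 := by
      rw [Finset.sum_mul]
      refine Finset.sum_le_sum fun j hj => ?_
      have hj' := Finset.mem_Ico.1 hj
      have : b n / 2 ≤ b j := by
        rcases hj'.1.eq_or_lt with rfl | hlt
        · linarith
        · exact (hmin j hlt hj'.2).1.le
      rw [sq]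
      exact mul_le_mul_of_nonneg_left this (hb j)
    have h2 : (∑ j ∈ Finset.Ico n m, b j) * (b n / 2) ≤ (2 * D * b n) * (b n / 2) := by
      calc _ ≤ _ := h1
        _ ≤ D * b n ^ 2 := hsq
        _ = _ := by ring
    exact le_of_mul_le_mul_right h2 (by linarith)
  refine ⟨m, hm.1, ?_⟩
  have han := hanti m hm.1.le
  have hcoef : 0 ≤ 4 * D * (2 * C ^ 3) := by positivity
  rcases hm.2 with h | h
  · have h5 : 0 ≤ (2 * D + 4 * D * (2 * C ^ 3)) * (futureRange x n - futureRange x m) :=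
      mul_nonneg (by positivity) (by linarith)
    have h6 : 4 * D * (b n / 2) ≤ 4 * D * (b n - b m) :=
      mul_le_mul_of_nonneg_left (by linarith) (by positivity)
    linarith
  · have hfar : ∀ r, (m : ℝ) ≤ r → b n ≤ |x n - x r| := by
      intro r hr
      have h7 := h.trans (hE n m hm.1.le r hr)
      have h8 : b n ^ 2 ≤ (x n - x r) ^ 2 := by
        have : C * (2 * b n ^ 2) ≤ C * (b n ^ 2 + (x n - x r) ^ 2) := by linarith
        have := le_of_mul_le_mul_left this hC0
        linarith
      rw [← sq_abs (x n - x r)] at h8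
      exact le_of_sq_le_sq h8 (abs_nonneg _)
    have h9 := futureRange_add_le hx hbd (Nat.cast_nonneg n) (Nat.cast_le.2 hm.1.le) hpos hfar
    have hbm : b m ≤ 2 * C ^ 3 * b n := by
      have h10 : b m ^ 2 ≤ (2 * C ^ 3 * b n) ^ 2 := by
        have h11 : b m ^ 2 ≤ (C * b k) ^ 2 := by
          rw [hk]; exact pow_le_pow_left₀ (hb _) (hstep k) 2
        have h12 : C ^ 2 * b k ^ 2 ≤ C ^ 2 * (2 * C ^ 3 * b n ^ 2) :=
          mul_le_mul_of_nonneg_left hkb.1 (by positivity)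
        have h13 : 0 ≤ C ^ 5 * b n ^ 2 := by positivity
        have h14 : C ^ 5 * b n ^ 2 * 1 ≤ C ^ 5 * b n ^ 2 * C :=
          mul_le_mul_of_nonneg_left hC h13
        nlinarith
      exact le_of_sq_le_sq h10 (by positivity)
    have h15 : (2 * D + 4 * D * (2 * C ^ 3)) * b n ≤
        (2 * D + 4 * D * (2 * C ^ 3)) * (futureRange x n - futureRange x m) :=
      mul_le_mul_of_nonneg_left (by linarith) (by positivity)
    have h16 : 4 * D * (-(2 * C ^ 3 * b n)) ≤ 4 * D * (b n - b m) :=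
      mul_le_mul_of_nonneg_left (by linarith) (by positivity)
    linarith

/-- Square-summability estimates with an initial and a displacement term along a scalar
observable imply summability. -/
theorem summable_of_dissipation {b : ℕ → ℝ} {x : ℝ → ℝ} {C R : ℝ} (hC : 1 ≤ C)
    (hb : ∀ n, 0 ≤ b n) (hstep : ∀ n, b (n + 1) ≤ C * b n)
    (hx : ContinuousOn x (Set.Ici 0)) (hbd : ∀ t, 0 ≤ t → |x t| ≤ R)
    (hE : ∀ n m : ℕ, n ≤ m → ∀ t : ℝ, (m : ℝ) ≤ t →
      ∑ j ∈ Finset.Ico n m, b j ^ 2 ≤ C * (b n ^ 2 + (x n - x t) ^ 2)) :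
    Summable b := by
  obtain ⟨A, B, hA, hB, hm⟩ := exists_sum_Ico_le hC hb hstep hx hbd hE
  have hΨ : ∀ n : ℕ, 0 ≤ A * futureRange x n + B * b n := fun n =>
    add_nonneg (mul_nonneg hA (futureRange_nonneg hbd (Nat.cast_nonneg n)))
      (mul_nonneg hB (hb n))
  have key : ∀ k n : ℕ, ∑ j ∈ Finset.Ico n (n + k), b j ≤ A * futureRange x n + B * b n := by
    intro k
    induction k using Nat.strong_induction_on with
    | _ k ih =>
      intro n
      obtain ⟨m, hnm, hsum⟩ := hm n
      rcases le_or_gt (n + k) m with h | h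
      · have h1 : ∑ j ∈ Finset.Ico n (n + k), b j ≤ ∑ j ∈ Finset.Ico n m, b j :=
          Finset.sum_le_sum_of_subset_of_nonneg (Finset.Ico_subset_Ico_right h)
            fun j _ _ => hb j
        linarith [hΨ m]
      · have h1 := ih (n + k - m) (by omega) m
        have h2 : m + (n + k - m) = n + k := by omega
        rw [h2] at h1
        rw [← Finset.sum_Ico_consecutive b hnm.le h.le]
        linarith
  refine summable_of_sum_range_le hb (c := A * futureRange x (0 : ℕ) + B * b 0) fun n => ?_
  have h := key n 0
  rwa [zero_add, ← Finset.range_eq_Ico] at h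

section DampedFlow

variable {w v γ : ℝ → ℂ} {M : ℂ} {K : ℝ}

theorem norm_sub_le_integral_norm (hv : Continuous v)
    (hw' : ∀ t, 0 ≤ t → HasDerivAt w (v t) t) {s t : ℝ} (hs : 0 ≤ s) (hst : s ≤ t) :
    ‖w t - w s‖ ≤ ∫ r in s..t, ‖v r‖ := by
  have h : ∫ r in s..t, v r = w t - w s := by
    refine integral_eq_sub_of_hasDerivAt (fun r hr => hw' r ?_) (hv.intervalIntegrable _ _)
    rw [Set.uIcc_of_le hst] at hr
    exact hs.trans hr.1
  rw [← h]
  exact intervalIntegral.norm_integral_le_integral_norm hst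

theorem integral_norm_mono (hv : Continuous v) {a b c d : ℝ} (hca : c ≤ a) (hab : a ≤ b)
    (hbd : b ≤ d) : ∫ r in a..b, ‖v r‖ ≤ ∫ r in c..d, ‖v r‖ :=
  intervalIntegral.integral_mono_interval hca hab hbd
    (Eventually.of_forall fun _ => norm_nonneg _) (hv.norm.intervalIntegrable _ _)

/-- For `w'' = -M w' - γ` with `γ` Lipschitz along `w`, velocity and force are controlled by the
length of the trajectory over the next unit of time. -/
theorem norm_add_norm_le_integral (hK : 0 ≤ K) (hv : Continuous v)
    (hw' : ∀ t, 0 ≤ t → HasDerivAt w (v t) t)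
    (hv' : ∀ t, 0 ≤ t → HasDerivAt v (-(M * v t) - γ t) t)
    (hγ : ∀ s t, 0 ≤ s → 0 ≤ t → ‖γ t - γ s‖ ≤ K * ‖w t - w s‖) {r : ℝ} (hr : 0 ≤ r) :
    ‖v r‖ + ‖γ r‖ ≤ (11 * (‖M‖ + K) + 17) * ∫ u in r..r + 1, ‖v u‖ := by
  set A := ∫ u in r..r + 1, ‖v u‖ with hA
  have hA0 : 0 ≤ A := intervalIntegral.integral_nonneg (by linarith) fun _ _ => norm_nonneg _
  have hdisp : ∀ τ ∈ Set.Icc (0 : ℝ) 1, ‖w (r + τ) - w r‖ ≤ A := fun τ hτ =>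
    (norm_sub_le_integral_norm hv hw' hr (by linarith [hτ.1])).trans
      (integral_norm_mono hv le_rfl (by linarith [hτ.1]) (by linarith [hτ.2]))
  have hshift : ∀ {g : ℝ → ℂ} {g' : ℂ} {τ : ℝ}, HasDerivAt g g' (r + τ) →
      HasDerivAt (fun τ => g (r + τ)) g' τ := fun h => h.comp_const_add r _
  have hid : ∀ τ : ℝ, HasDerivAt (fun τ : ℝ => (τ : ℂ)) 1 τ := fun τ =>
    (hasDerivAt_id τ).ofReal_comp
  have hp' : ∀ τ : ℝ, 0 ≤ τ → HasDerivAt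
      (fun τ : ℝ => v (r + τ) + M * w (r + τ) + (τ : ℂ) * γ r) (γ r - γ (r + τ)) τ := by
    intro τ hτ
    have h := ((hshift (hv' (r + τ) (by linarith))).add
      ((hshift (hw' (r + τ) (by linarith))).const_mul M)).add ((hid τ).mul_const (γ r))
    exact h.congr_deriv (by ring)
  have hp : ∀ τ ∈ Set.Icc (0 : ℝ) 1, ‖v (r + τ) - v r + (τ : ℂ) * γ r‖ ≤ (‖M‖ + K) * A := by
    intro τ hτ
    have h := norm_image_sub_le_of_norm_deriv_right_le_segment (a := 0) (b := 1)
      (C := K * A)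
      (fun τ hτ => (hp' τ hτ.1).continuousAt.continuousWithinAt)
      (fun τ hτ => (hp' τ hτ.1).hasDerivWithinAt)
      (fun τ hτ => by
        rw [norm_sub_rev]
        refine (hγ r (r + τ) hr (by linarith [hτ.1])).trans ?_
        exact mul_le_mul_of_nonneg_left (hdisp τ ⟨hτ.1, hτ.2.le⟩) hK) τ hτ
    have h1 : K * A * (τ - 0) ≤ K * A :=
      mul_le_of_le_one_right (mul_nonneg hK hA0) (by linarith [hτ.2])
    have h2 : ‖M * (w (r + τ) - w r)‖ ≤ ‖M‖ * A := by
      rw [norm_mul]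
      exact mul_le_mul_of_nonneg_left (hdisp τ hτ) (norm_nonneg _)
    have h3 : v (r + τ) - v r + (τ : ℂ) * γ r =
        (v (r + τ) + M * w (r + τ) + (τ : ℂ) * γ r -
          (v (r + 0) + M * w (r + 0) + ((0 : ℝ) : ℂ) * γ r)) - M * (w (r + τ) - w r) := by
      simp only [add_zero, Complex.ofReal_zero, zero_mul]
      ring
    rw [h3]
    refine (norm_sub_le _ _).trans ?_
    linarith
  have hq' : ∀ τ : ℝ, 0 ≤ τ → HasDerivAt
      (fun τ : ℝ => w (r + τ) - (τ : ℂ) * v r + (τ : ℂ) * (τ : ℂ) * (γ r / 2))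
      (v (r + τ) - v r + (τ : ℂ) * γ r) τ := by
    intro τ hτ
    have h := ((hshift (hw' (r + τ) (by linarith))).sub ((hid τ).mul_const (v r))).add
      (((hid τ).mul (hid τ)).mul_const (γ r / 2))
    exact h.congr_deriv (by ring)
  have hq : ∀ τ ∈ Set.Icc (0 : ℝ) 1,
      ‖w (r + τ) - w r - (τ : ℂ) * v r + (τ : ℂ) * (τ : ℂ) * (γ r / 2)‖
        ≤ (‖M‖ + K) * A * τ := by
    intro τ hτ
    have h := norm_image_sub_le_of_norm_deriv_right_le_segment (a := 0) (b := 1)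
      (fun τ hτ => (hq' τ hτ.1).continuousAt.continuousWithinAt)
      (fun τ hτ => (hq' τ hτ.1).hasDerivWithinAt)
      (fun τ hτ => hp τ ⟨hτ.1, hτ.2.le⟩) τ hτ
    simp only [add_zero, Complex.ofReal_zero, zero_mul, sub_zero] at h
    have h3 : w (r + τ) - w r - (τ : ℂ) * v r + (τ : ℂ) * (τ : ℂ) * (γ r / 2) =
        w (r + τ) - (τ : ℂ) * v r + (τ : ℂ) * (τ : ℂ) * (γ r / 2) - w r := by ring
    rw [h3]
    exact h
  set Q := (‖M‖ + K) * A with hQ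
  have e1 : ‖v r - γ r / 2‖ ≤ Q + A := by
    have h := hq 1 (by norm_num)
    have hd := hdisp 1 (by norm_num)
    have h3 : v r - γ r / 2 = (w (r + 1) - w r) -
        (w (r + 1) - w r - ((1 : ℝ) : ℂ) * v r + ((1 : ℝ) : ℂ) * ((1 : ℝ) : ℂ) * (γ r / 2)) := by
      push_cast; ring
    rw [h3]
    refine (norm_sub_le _ _).trans ?_
    linarith
  have e2 : ‖v r - γ r / 4‖ ≤ Q + 2 * A := by
    have h := hq (1 / 2) (by norm_num)
    have hd := hdisp (1 / 2) (by norm_num)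
    have h3 : v r - γ r / 4 = 2 * ((w (r + 1 / 2) - w r) -
        (w (r + 1 / 2) - w r - ((1 / 2 : ℝ) : ℂ) * v r
          + ((1 / 2 : ℝ) : ℂ) * ((1 / 2 : ℝ) : ℂ) * (γ r / 2))) := by
      push_cast; ring
    rw [h3, norm_mul, Complex.norm_ofNat]
    have := norm_sub_le (w (r + 1 / 2) - w r) (w (r + 1 / 2) - w r - ((1 / 2 : ℝ) : ℂ) * v r
          + ((1 / 2 : ℝ) : ℂ) * ((1 / 2 : ℝ) : ℂ) * (γ r / 2))
    linarith
  have e3 : ‖γ r‖ ≤ 4 * (2 * Q + 3 * A) := by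
    have h3 : γ r = 4 * ((v r - γ r / 4) - (v r - γ r / 2)) := by ring
    rw [h3, norm_mul, Complex.norm_ofNat]
    have := norm_sub_le (v r - γ r / 4) (v r - γ r / 2)
    linarith
  have e4 : ‖v r‖ ≤ Q + 2 * A + ‖γ r‖ / 4 := by
    have h3 : v r = (v r - γ r / 4) + γ r / 4 := by ring
    have h4 : ‖γ r / 4‖ = ‖γ r‖ / 4 := by rw [norm_div, Complex.norm_ofNat]
    calc ‖v r‖ = ‖(v r - γ r / 4) + γ r / 4‖ := by rw [← h3]
      _ ≤ ‖v r - γ r / 4‖ + ‖γ r / 4‖ := norm_add_le _ _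
      _ ≤ _ := by linarith
  have : (11 * (‖M‖ + K) + 17) * A = 11 * Q + 17 * A := by rw [hQ]; ring
  rw [this]
  linarith

/-- For `w'' = -M w' - γ` with `γ` Lipschitz along `w`, velocity and force grow by at most a
constant factor in a unit of time. -/
theorem norm_add_norm_le_of_le_add_one (hK : 0 ≤ K)
    (hw' : ∀ t, 0 ≤ t → HasDerivAt w (v t) t)
    (hv' : ∀ t, 0 ≤ t → HasDerivAt v (-(M * v t) - γ t) t)
    (hγ : ∀ s t, 0 ≤ s → 0 ≤ t → ‖γ t - γ s‖ ≤ K * ‖w t - w s‖) {s t : ℝ} (hs : 0 ≤ s)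
    (hst : s ≤ t) (hts : t ≤ s + 1) :
    ‖v t‖ + ‖γ t‖ ≤ (rexp (1 + ‖M‖ + K) * (1 + K) + 1) * (‖v s‖ + ‖γ s‖) := by
  set L := 1 + ‖M‖ + K with hL
  have hL1 : 1 ≤ L := by have := norm_nonneg M; linarith
  let F : ℝ → ℂ × ℂ := fun t => (w t - w s, v t)
  have hF : ∀ t, 0 ≤ t → HasDerivAt F (v t, -(M * v t) - γ t) t := fun t ht =>
    ((hw' t ht).sub_const _).prodMk (hv' t ht)
  have hbound : ∀ r ∈ Set.Ico s (s + 1), ‖(v r, -(M * v r) - γ r)‖ ≤ L * ‖F r‖ + ‖γ s‖ := by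
    intro r hr
    have h1 : ‖w r - w s‖ ≤ ‖F r‖ := norm_fst_le (F r)
    have h2 : ‖v r‖ ≤ ‖F r‖ := norm_snd_le (F r)
    have h3 : ‖γ r‖ ≤ ‖γ s‖ + K * ‖F r‖ := by
      have h4 := hγ s r hs (hs.trans hr.1)
      have h5 := norm_le_norm_add_norm_sub' (γ r) (γ s)
      have h6 := mul_le_mul_of_nonneg_left h1 hK
      linarith
    have h7 : ‖M‖ * ‖v r‖ ≤ ‖M‖ * ‖F r‖ := mul_le_mul_of_nonneg_left h2 (norm_nonneg _)
    have h8 : ‖-(M * v r) - γ r‖ ≤ ‖M‖ * ‖v r‖ + ‖γ r‖ := by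
      refine (norm_sub_le _ _).trans ?_
      rw [norm_neg, norm_mul]
    have h9 : 0 ≤ ‖M‖ * ‖F r‖ := by positivity
    have h10 : 0 ≤ K * ‖F r‖ := by positivity
    rw [Prod.norm_mk, max_le_iff, hL]
    constructor
    · nlinarith [norm_nonneg (γ s)]
    · nlinarith [norm_nonneg (F r)]
  have hg := norm_le_gronwallBound_of_norm_deriv_right_le (a := s) (b := s + 1) (δ := ‖v s‖)
    (fun r hr => (hF r (hs.trans hr.1)).continuousAt.continuousWithinAt)
    (fun r hr => (hF r (hs.trans hr.1)).hasDerivWithinAt)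
    (by simp [F]) hbound t ⟨hst, hts⟩
  rw [gronwallBound_of_K_ne_0 (by linarith)] at hg
  have hexp : rexp (L * (t - s)) ≤ rexp L := by
    rw [Real.exp_le_exp]
    exact mul_le_of_le_one_right (by linarith) (by linarith)
  have hFle : ‖F t‖ ≤ rexp L * (‖v s‖ + ‖γ s‖) := by
    have h1 : ‖v s‖ * rexp (L * (t - s)) ≤ ‖v s‖ * rexp L :=
      mul_le_mul_of_nonneg_left hexp (norm_nonneg _)
    have h2 : ‖γ s‖ / L * (rexp (L * (t - s)) - 1) ≤ ‖γ s‖ * rexp L := by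
      refine mul_le_mul (div_le_self (norm_nonneg _) hL1) (by linarith) ?_ (norm_nonneg _)
      have : 1 ≤ rexp (L * (t - s)) :=
        Real.one_le_exp (mul_nonneg (by linarith) (by linarith))
      linarith
    have h3 : rexp L * (‖v s‖ + ‖γ s‖) = ‖v s‖ * rexp L + ‖γ s‖ * rexp L := by ring
    rw [h3]
    exact hg.trans (add_le_add h1 h2)
  have h1 : ‖w t - w s‖ ≤ ‖F t‖ := norm_fst_le (F t)
  have h2 : ‖v t‖ ≤ ‖F t‖ := norm_snd_le (F t)
  have h4 := hγ s t hs (hs.trans hst)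
  have h5 := norm_le_norm_add_norm_sub' (γ t) (γ s)
  have h6 := mul_le_mul_of_nonneg_left (h1.trans hFle) hK
  have h7 := h2.trans hFle
  nlinarith [norm_nonneg (v s)]

theorem sq_integral_le_integral_sq {f : ℝ → ℝ} (hf : Continuous f) (a : ℝ) :
    (∫ r in a..a + 1, f r) ^ 2 ≤ ∫ r in a..a + 1, f r ^ 2 := by
  set m := ∫ r in a..a + 1, f r with hm
  have h0 : 0 ≤ ∫ r in a..a + 1, (f r - m) ^ 2 :=
    intervalIntegral.integral_nonneg (by linarith) fun _ _ => sq_nonneg _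
  have h1 : ∫ r in a..a + 1, (f r - m) ^ 2 = (∫ r in a..a + 1, f r ^ 2) - 2 * m * m + m ^ 2 := by
    have h2 : ∀ r, (f r - m) ^ 2 = (f r ^ 2 - 2 * m * f r) + m ^ 2 := fun r => by ring
    simp_rw [h2]
    rw [intervalIntegral.integral_add, intervalIntegral.integral_sub,
      intervalIntegral.integral_const_mul, intervalIntegral.integral_const, ← hm]
    · simp
    all_goals exact Continuous.intervalIntegrable (by fun_prop) _ _
  nlinarith

/-- A damped flow with Lipschitz force whose dissipated energy is controlled by the initial
velocity, the initial force and the displacement of a bounded scalar observable has finite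
length, and its velocity and force tend to zero. -/
theorem integrableOn_and_tendsto_of_dissipation {x : ℝ → ℝ} {C R : ℝ} (hK : 0 ≤ K)
    (hv : Continuous v)
    (hw' : ∀ t, 0 ≤ t → HasDerivAt w (v t) t)
    (hv' : ∀ t, 0 ≤ t → HasDerivAt v (-(M * v t) - γ t) t)
    (hγ : ∀ s t, 0 ≤ s → 0 ≤ t → ‖γ t - γ s‖ ≤ K * ‖w t - w s‖)
    (hx : ContinuousOn x (Set.Ici 0)) (hbd : ∀ t, 0 ≤ t → |x t| ≤ R) (hC : 0 ≤ C)
    (hE : ∀ s t, 0 ≤ s → s ≤ t →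
      ∫ r in s..t, ‖v r‖ ^ 2 ≤ C * ((‖v s‖ + ‖γ s‖) ^ 2 + (x s - x t) ^ 2)) :
    IntegrableOn v (Set.Ioi 0) ∧ Tendsto (fun t => ‖v t‖ + ‖γ t‖) atTop (𝓝 0) := by
  set C1 := 11 * (‖M‖ + K) + 17 with hC1
  set C2 := rexp (1 + ‖M‖ + K) * (1 + K) + 1 with hC2
  have hC1' : 0 ≤ C1 := by positivity
  have hC2' : 1 ≤ C2 := by
    have : 0 ≤ rexp (1 + ‖M‖ + K) * (1 + K) := by positivity
    linarith
  set b : ℕ → ℝ := fun n => ‖v n‖ + ‖γ n‖ with hb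
  have hb0 : ∀ n, 0 ≤ b n := fun n => by positivity
  have hsq_int : ∀ a c, IntervalIntegrable (fun r => ‖v r‖ ^ 2) volume a c := fun a c =>
    Continuous.intervalIntegrable (by fun_prop) _ _
  have hsum : Summable b := by
    refine summable_of_dissipation (x := x) (R := R) (C := C2 + C1 ^ 2 * C)
      (by nlinarith [mul_nonneg (sq_nonneg C1) hC]) hb0 (fun n => ?_) hx hbd
      (fun n m hnm t hmt => ?_)
    · have h := norm_add_norm_le_of_le_add_one hK hw' hv' hγ (Nat.cast_nonneg n)
        (by linarith : (n : ℝ) ≤ n + 1) le_rfl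
      have h1 : 0 ≤ C1 ^ 2 * C * b n := mul_nonneg (mul_nonneg (sq_nonneg _) hC) (hb0 n)
      simp only [hb] at h1 ⊢
      push_cast
      linarith
    · have h1 : ∀ j : ℕ, b j ^ 2 ≤ C1 ^ 2 * ∫ r in (j : ℝ)..((j + 1 : ℕ) : ℝ), ‖v r‖ ^ 2 := by
        intro j
        have h2 := norm_add_norm_le_integral hK hv hw' hv' hγ (Nat.cast_nonneg j)
        have h3 := sq_integral_le_integral_sq hv.norm (j : ℝ)
        have h4 := pow_le_pow_left₀ (hb0 j) h2 2
        rw [mul_pow] at h4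
        push_cast
        exact h4.trans (mul_le_mul_of_nonneg_left h3 (sq_nonneg _))
      have h5 : ∑ j ∈ Finset.Ico n m, b j ^ 2 ≤ C1 ^ 2 * ∫ r in (n : ℝ)..(m : ℝ), ‖v r‖ ^ 2 := by
        rw [← intervalIntegral.sum_integral_adjacent_intervals_Ico
          (a := fun k : ℕ => (k : ℝ)) hnm (fun k _ => hsq_int _ _), Finset.mul_sum]
        exact Finset.sum_le_sum fun j _ => h1 j
      have h6 : ∫ r in (n : ℝ)..(m : ℝ), ‖v r‖ ^ 2 ≤ ∫ r in (n : ℝ)..t, ‖v r‖ ^ 2 :=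
        intervalIntegral.integral_mono_interval le_rfl (Nat.cast_le.2 hnm) hmt
          (Eventually.of_forall fun _ => sq_nonneg _) (hsq_int _ _)
      have h7 := hE n t (Nat.cast_nonneg n) ((Nat.cast_le.2 hnm).trans hmt)
      have h8 := mul_le_mul_of_nonneg_left (h6.trans h7) (sq_nonneg C1)
      have h9 : 0 ≤ C2 * (b n ^ 2 + (x n - x t) ^ 2) := by positivity
      simp only [hb] at h5 h9 ⊢
      nlinarith
  have hwin : ∀ n : ℕ, ∫ r in (n : ℝ)..((n + 1 : ℕ) : ℝ), ‖v r‖ ≤ C2 * b n := by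
    intro n
    have h : ∫ r in (n : ℝ)..((n + 1 : ℕ) : ℝ), ‖v r‖ ≤
        ∫ r in (n : ℝ)..((n + 1 : ℕ) : ℝ), C2 * b n := by
      refine intervalIntegral.integral_mono_on (by simp) (hv.norm.intervalIntegrable _ _)
        (by simp) fun r hr => ?_
      have h1 := norm_add_norm_le_of_le_add_one hK hw' hv' hγ (Nat.cast_nonneg n) hr.1
        (by simpa using hr.2)
      linarith [norm_nonneg (γ r)]
    simpa using h
  constructor
  · refine integrableOn_Ioi_of_intervalIntegral_norm_bounded (C2 * ∑' n, b n) 0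
      (b := fun n : ℕ => (n : ℝ)) (l := atTop) (fun n => ?_) tendsto_natCast_atTop_atTop
      (Eventually.of_forall fun n => ?_)
    · exact hv.integrableOn_Ioc
    · have h := intervalIntegral.sum_integral_adjacent_intervals
        (a := fun k : ℕ => (k : ℝ)) (n := n) (f := fun r => ‖v r‖) (μ := volume)
        (fun k _ => hv.norm.intervalIntegrable _ _)
      simp only [Nat.cast_zero] at h
      rw [← h]
      calc _ ≤ ∑ k ∈ Finset.range n, C2 * b k := Finset.sum_le_sum fun k _ => hwin k
        _ = C2 * ∑ k ∈ Finset.range n, b k := by rw [Finset.mul_sum]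
        _ ≤ _ := mul_le_mul_of_nonneg_left (hsum.sum_le_tsum _ fun i _ => hb0 i) (by linarith)
  · have h1 : Tendsto (fun t : ℝ => C2 * b ⌊t⌋₊) atTop (𝓝 0) := by
      simpa using (hsum.tendsto_atTop_zero.comp
        (tendsto_nat_floor_atTop (α := ℝ))).const_mul C2
    refine squeeze_zero' (Eventually.of_forall fun t => by positivity) ?_ h1
    filter_upwards [eventually_ge_atTop 0] with t ht
    exact norm_add_norm_le_of_le_add_one hK hw' hv' hγ (Nat.cast_nonneg _) (Nat.floor_le ht)
      (Nat.lt_floor_add_one t).le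

end DampedFlow

theorem exists_lipschitz_radial {g : ℝ → ℝ} (hg : LocallyLipschitzOn (Set.Ioi (0 : ℝ)) g)
    {a b : ℝ} (ha : 0 < a) (hab : a ≤ b) :
    ∃ K : ℝ, 0 ≤ K ∧ ∀ z z' : ℂ, ‖z‖ ∈ Set.Icc a b → ‖z'‖ ∈ Set.Icc a b →
      ‖(g ‖z‖ : ℂ) * z - (g ‖z'‖ : ℂ) * z'‖ ≤ K * ‖z - z'‖ := by
  have hsub : Set.Icc a b ⊆ Set.Ioi (0 : ℝ) := fun r hr => ha.trans_le hr.1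
  obtain ⟨L, hL⟩ := (hg.mono hsub).exists_lipschitzOnWith_of_compact isCompact_Icc
  obtain ⟨B, hB⟩ := isCompact_Icc.exists_bound_of_continuousOn (hg.continuousOn.mono hsub)
  have hB0 : 0 ≤ B := (norm_nonneg _).trans (hB a ⟨le_rfl, hab⟩)
  refine ⟨L * b + B, by have := ha.le.trans hab; positivity, fun z z' hz hz' => ?_⟩
  have h1 : ‖((g ‖z‖ - g ‖z'‖ : ℝ) : ℂ) * z‖ ≤ L * b * ‖z - z'‖ := by
    rw [norm_mul, Complex.norm_real]
    have h2 := hL.dist_le_mul _ hz _ hz'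
    rw [Real.dist_eq, Real.dist_eq] at h2
    have h3 : ‖g ‖z‖ - g ‖z'‖‖ ≤ L * ‖z - z'‖ :=
      h2.trans (mul_le_mul_of_nonneg_left (abs_norm_sub_norm_le z z') L.coe_nonneg)
    calc _ ≤ L * ‖z - z'‖ * b := mul_le_mul h3 hz.2 (norm_nonneg _) (by positivity)
      _ = _ := by ring
  have h4 : ‖(g ‖z'‖ : ℂ) * (z - z')‖ ≤ B * ‖z - z'‖ := by
    rw [norm_mul, Complex.norm_real]
    exact mul_le_mul_of_nonneg_right (hB _ hz') (norm_nonneg _)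
  have h5 : (g ‖z‖ : ℂ) * z - (g ‖z'‖ : ℂ) * z' =
      ((g ‖z‖ - g ‖z'‖ : ℝ) : ℂ) * z + (g ‖z'‖ : ℂ) * (z - z') := by
    push_cast; ring
  rw [h5]
  refine (norm_add_le _ _).trans ?_
  linarith

theorem HasDerivAt.norm_of_ne_zero {w : ℝ → ℂ} {w' : ℂ} {t : ℝ} (h : HasDerivAt w w' t)
    (h0 : w t ≠ 0) : HasDerivAt (fun s => ‖w s‖) (⟪w t, w'⟫ / ‖w t‖) t := by
  have h1 := h.norm_sq.sqrt (pow_ne_zero 2 (norm_ne_zero_iff.2 h0))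
  have h2 : ∀ s, √(‖w s‖ ^ 2) = ‖w s‖ := fun s => Real.sqrt_sq (norm_nonneg _)
  simp only [h2] at h1
  exact h1.congr_deriv (by field_simp)

theorem hasDerivAt_radial_potential {h : ℝ → ℝ} (hh : ContinuousOn h (Set.Ioi 0))
    {a r : ℝ} (ha : 0 < a) (hr : 0 < r) :
    HasDerivAt (fun r => ∫ s in a..r, s * h s) (r * h r) r := by
  have hc : ContinuousOn (fun s => s * h s) (Set.Ioi 0) := continuousOn_id.mul hh
  refine intervalIntegral.integral_hasDerivAt_right
    (hc.mono fun s hs => ?_).intervalIntegrable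
    (hc.stronglyMeasurableAtFilter isOpen_Ioi r hr) (hc.continuousAt (Ioi_mem_nhds hr))
  exact (lt_min ha hr).trans_le (Set.mem_uIcc.1 hs |>.elim (fun h => (min_le_left _ _).trans h.1)
    fun h => (min_le_right _ _).trans h.1)

/-- A damped planar flow in a radial potential with Lipschitz force that confines trajectories
to an annulus has finite length and converges to an equilibrium, for an arbitrary zero set of
the radial force. -/
theorem damped_radial_flow_converges {h : ℝ → ℝ} (hh : LocallyLipschitzOn (Set.Ioi (0 : ℝ)) h)
    {a : ℝ} (ha : 0 < a)
    (hG0 : ∀ B : ℝ, ∃ r₁, 0 < r₁ ∧ ∀ r, 0 < r → r ≤ r₁ → B < ∫ s in a..r, s * h s)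
    (hG1 : ∀ B : ℝ, ∃ r₂, ∀ r, r₂ ≤ r → B < ∫ s in a..r, s * h s)
    {w v : ℝ → ℂ} {M : ℂ} (hM : 0 < M.re) (hv : Continuous v)
    (hw' : ∀ t, 0 ≤ t → HasDerivAt w (v t) t)
    (hv' : ∀ t, 0 ≤ t → HasDerivAt v (-(M * v t) - (h ‖w t‖ : ℂ) * w t) t)
    (hw0 : ∀ t, 0 ≤ t → w t ≠ 0) :
    IntegrableOn v (Set.Ioi 0) ∧
    (∃ r₁ r₂ : ℝ, 0 < r₁ ∧ r₁ ≤ r₂ ∧ ∀ t, 0 ≤ t → ‖w t‖ ∈ Set.Icc r₁ r₂) ∧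
    ∃ wlim : ℂ, wlim ≠ 0 ∧ h ‖wlim‖ = 0 ∧ Tendsto w atTop (𝓝 wlim) := by
  set G : ℝ → ℝ := fun r => ∫ s in a..r, s * h s with hG
  have hhc := hh.continuousOn
  have hw0' : ∀ t, 0 ≤ t → 0 < ‖w t‖ := fun t ht => norm_pos_iff.2 (hw0 t ht)
  set E : ℝ → ℝ := fun t => ‖v t‖ ^ 2 / 2 + G ‖w t‖ with hE
  have hE' : ∀ t, 0 ≤ t → HasDerivAt E (-(M.re * ‖v t‖ ^ 2)) t := by
    intro t ht
    have h1 := ((hv' t ht).norm_sq.div_const 2).add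
      ((hasDerivAt_radial_potential hhc ha (hw0' t ht)).comp t
        ((hw' t ht).norm_of_ne_zero (hw0 t ht)))
    refine h1.congr_deriv ?_
    have h2 : ‖w t‖ * h ‖w t‖ * (⟪w t, v t⟫ / ‖w t‖) = h ‖w t‖ * ⟪w t, v t⟫ := by
      have := (hw0' t ht).ne'
      field_simp
    rw [h2, ← Complex.normSq_eq_norm_sq, Complex.normSq_apply]
    simp only [Complex.inner, Complex.mul_re, Complex.conj_re, Complex.conj_im, Complex.sub_re,
      Complex.sub_im, Complex.neg_re, Complex.neg_im, Complex.mul_im, Complex.ofReal_re,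
      Complex.ofReal_im]
    ring
  have hdiss : ∀ s t, 0 ≤ s → s ≤ t → M.re * ∫ r in s..t, ‖v r‖ ^ 2 = E s - E t := by
    intro s t hs hst
    have h1 : ∫ r in s..t, -(M.re * ‖v r‖ ^ 2) = E t - E s := by
      refine integral_eq_sub_of_hasDerivAt (fun r hr => hE' r ?_)
        (Continuous.intervalIntegrable (by fun_prop) _ _)
      rw [Set.uIcc_of_le hst] at hr
      exact hs.trans hr.1
    rw [intervalIntegral.integral_neg, intervalIntegral.integral_const_mul] at h1
    linarith
  have hE0 : ∀ t, 0 ≤ t → G ‖w t‖ ≤ E 0 := by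
    intro t ht
    have h1 := hdiss 0 t le_rfl ht
    have h2 : 0 ≤ M.re * ∫ r in (0 : ℝ)..t, ‖v r‖ ^ 2 :=
      mul_nonneg hM.le (intervalIntegral.integral_nonneg ht fun _ _ => sq_nonneg _)
    have h3 : G ‖w t‖ ≤ E t := by
      simp only [hE]
      linarith [sq_nonneg ‖v t‖]
    linarith
  obtain ⟨r₁, hr₁, hlow⟩ := hG0 (E 0)
  obtain ⟨r₂, hhigh⟩ := hG1 (E 0)
  have hmem : ∀ t, 0 ≤ t → ‖w t‖ ∈ Set.Icc r₁ r₂ := by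
    intro t ht
    have h1 := hE0 t ht
    constructor
    · by_contra! hlt
      exact absurd (hlow _ (hw0' t ht) hlt.le) (not_lt.2 h1)
    · by_contra! hlt
      exact absurd (hhigh _ hlt.le) (not_lt.2 h1)
  have hr12 : r₁ ≤ r₂ := (hmem 0 le_rfl).1.trans (hmem 0 le_rfl).2
  obtain ⟨K, hK, hLip⟩ := exists_lipschitz_radial hh hr₁ hr12
  have hGdiff : ∀ x ∈ Set.Icc r₁ r₂, ∀ y ∈ Set.Icc r₁ r₂,
      G x - G y ≤ (|h x| * x + K * |x - y|) * |x - y| := by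
    intro x hx y hy
    have hpos : Set.uIcc y x ⊆ Set.Icc r₁ r₂ := Set.uIcc_subset_Icc hy hx
    have h1 : ∫ s in y..x, s * h s = G x - G y := by
      refine integral_eq_sub_of_hasDerivAt
        (fun r hr => hasDerivAt_radial_potential hhc ha (hr₁.trans_le (hpos hr).1)) ?_
      exact ((continuousOn_id.mul hhc).mono fun r hr =>
        hr₁.trans_le (hpos hr).1).intervalIntegrable
    rw [← h1]
    refine (le_abs_self _).trans ?_
    rw [← Real.norm_eq_abs]
    refine intervalIntegral.norm_integral_le_of_norm_le_const fun r hr => ?_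
    have hr' := Set.uIoc_subset_uIcc hr
    have hrm := hpos hr'
    have hx0 : 0 < x := hr₁.trans_le hx.1
    have hr0 : 0 < r := hr₁.trans_le hrm.1
    have hnx : ‖(x : ℂ)‖ = x := by rw [Complex.norm_real, Real.norm_of_nonneg hx0.le]
    have hnr : ‖(r : ℂ)‖ = r := by rw [Complex.norm_real, Real.norm_of_nonneg hr0.le]
    have h2 := hLip r x (by rwa [hnr]) (by rwa [hnx])
    rw [hnx, hnr] at h2
    have h2' : |h r * r - h x * x| ≤ K * |r - x| := by
      have e1 : (h r : ℂ) * r - (h x : ℂ) * x = ((h r * r - h x * x : ℝ) : ℂ) := by push_cast; ring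
      have e2 : (r : ℂ) - x = ((r - x : ℝ) : ℂ) := by push_cast; ring
      rwa [e1, e2, Complex.norm_real, Complex.norm_real, Real.norm_eq_abs,
        Real.norm_eq_abs] at h2
    have h3 : |r - x| ≤ |x - y| := by
      rw [abs_sub_comm r x]
      exact Set.abs_sub_right_of_mem_uIcc hr'
    have h4 : |h r * r| ≤ |h x * x| + |h r * r - h x * x| := by
      have := abs_add_le (h x * x) (h r * r - h x * x)
      simpa using this
    rw [abs_mul (h x), abs_of_pos hx0] at h4
    rw [Real.norm_eq_abs, mul_comm]
    have h5 := mul_le_mul_of_nonneg_left h3 hK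
    linarith
  have hγ : ∀ s t, 0 ≤ s → 0 ≤ t →
      ‖(h ‖w t‖ : ℂ) * w t - (h ‖w s‖ : ℂ) * w s‖ ≤ K * ‖w t - w s‖ := fun s t hs ht =>
    hLip _ _ (hmem t ht) (hmem s hs)
  have hwc : ContinuousOn w (Set.Ici 0) := fun t ht =>
    (hw' t ht).continuousAt.continuousWithinAt
  obtain ⟨hintg, hlim⟩ := integrableOn_and_tendsto_of_dissipation (x := fun t => ‖w t‖)
    (C := (1 + K) / M.re) (R := r₂) hK hv hw' hv' hγ hwc.norm
    (fun t ht => by rw [abs_norm]; exact (hmem t ht).2) (by positivity)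
    (fun s t hs hst => by
      have h1 := hdiss s t hs hst
      have h2 := hGdiff _ (hmem s hs) _ (hmem t (hs.trans hst))
      have h3 : ‖(h ‖w s‖ : ℂ) * w s‖ = |h ‖w s‖| * ‖w s‖ := by
        rw [norm_mul, Complex.norm_real, Real.norm_eq_abs]
      rw [h3, div_mul_eq_mul_div, le_div_iff₀ hM, mul_comm _ M.re, h1]
      set p := |h ‖w s‖| * ‖w s‖
      have hp : 0 ≤ p := by positivity
      set d := |‖w s‖ - ‖w t‖| with hd
      rw [← sq_abs (‖w s‖ - ‖w t‖), ← hd]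
      have hvs := norm_nonneg (v s)
      simp only [hE]
      have h4 : 0 ≤ K * (‖v s‖ + p) ^ 2 := by positivity
      nlinarith [sq_nonneg (p - d), sq_nonneg ‖v t‖, mul_nonneg hvs hp])
  refine ⟨hintg, ⟨r₁, r₂, hr₁, hr12, hmem⟩, ?_⟩
  have hwl := tendsto_limUnder_of_hasDerivAt_of_integrableOn_Ioi (a := 0)
    (fun t ht => hw' t (le_of_lt ht)) hintg
  set wlim := limUnder atTop w
  have hnl : r₁ ≤ ‖wlim‖ := ge_of_tendsto hwl.norm (by
    filter_upwards [eventually_ge_atTop 0] with t ht using (hmem t ht).1)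
  have hpos : 0 < ‖wlim‖ := hr₁.trans_le hnl
  have hwl0 : wlim ≠ 0 := norm_pos_iff.1 hpos
  refine ⟨wlim, hwl0, ?_, hwl⟩
  have h1 : Tendsto (fun t => (h ‖w t‖ : ℂ) * w t) atTop (𝓝 ((h ‖wlim‖ : ℂ) * wlim)) := by
    refine Tendsto.mul ?_ hwl
    exact (Complex.continuous_ofReal.tendsto _).comp
      ((hhc.continuousAt (Ioi_mem_nhds hpos)).tendsto.comp hwl.norm)
  have h2 : Tendsto (fun t => (h ‖w t‖ : ℂ) * w t) atTop (𝓝 0) :=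
    squeeze_zero_norm (fun t => le_add_of_nonneg_left (norm_nonneg (v t))) hlim
  have h3 := tendsto_nhds_unique h1 h2
  simpa [hwl0] using h3

theorem integrableOn_Ioi_integral_window {f : ℝ → ℝ} (hf : Continuous f) (hf0 : ∀ t, 0 ≤ f t)
    (hintg : IntegrableOn f (Set.Ioi 0)) {d : ℝ} (hd : 0 ≤ d) :
    IntegrableOn (fun s => ∫ r in s..s + d, f r) (Set.Ioi 0) := by
  set V : ℝ → ℝ := fun t => ∫ r in (0 : ℝ)..t, f r with hV
  have hVc : Continuous V := by
    exact intervalIntegral.continuous_primitive (fun a b => hf.intervalIntegrable a b) 0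
  have hQ : ∀ s, ∫ r in s..s + d, f r = V (s + d) - V s := fun s =>
    (intervalIntegral.integral_interval_sub_left (hf.intervalIntegrable _ _)
      (hf.intervalIntegrable _ _)).symm
  have hVd : Continuous fun s => V (s + d) := hVc.comp (by fun_prop)
  have hV0 : ∀ t, 0 ≤ t → 0 ≤ V t := fun t ht =>
    intervalIntegral.integral_nonneg ht fun r _ => hf0 r
  have hVle : ∀ t, 0 ≤ t → V t ≤ ∫ r in Set.Ioi (0 : ℝ), f r := by
    intro t ht
    simp only [hV]
    rw [intervalIntegral.integral_of_le ht]
    exact setIntegral_mono_set hintg (Eventually.of_forall fun r => hf0 r)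
      Set.Ioc_subset_Ioi_self.eventuallyLE
  simp_rw [hQ]
  refine integrableOn_Ioi_of_intervalIntegral_norm_bounded (d * ∫ r in Set.Ioi (0 : ℝ), f r) 0
    (b := id) (l := atTop) (fun T => (hVd.sub hVc).integrableOn_Ioc) tendsto_id ?_
  filter_upwards [eventually_ge_atTop 0] with T hT
  have h1 : ∀ s, ‖V (s + d) - V s‖ = V (s + d) - V s := fun s => by
    rw [← hQ, Real.norm_of_nonneg]
    exact intervalIntegral.integral_nonneg (by linarith) fun r _ => hf0 r
  simp_rw [h1]
  rw [id, intervalIntegral.integral_sub (hVd.intervalIntegrable _ _) (hVc.intervalIntegrable _ _),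
    intervalIntegral.integral_comp_add_right, zero_add]
  have i1 := intervalIntegral.integral_add_adjacent_intervals
    (hVc.intervalIntegrable (μ := volume) 0 d)
    (hVc.intervalIntegrable d (T + d))
  have i2 := intervalIntegral.integral_add_adjacent_intervals
    (hVc.intervalIntegrable (μ := volume) 0 T)
    (hVc.intervalIntegrable T (T + d))
  have i3 : 0 ≤ ∫ s in (0 : ℝ)..d, V s :=
    intervalIntegral.integral_nonneg hd fun s hs => hV0 s hs.1
  have i4 : ∫ s in T..T + d, V s ≤ ∫ s in T..T + d, ∫ r in Set.Ioi (0 : ℝ), f r :=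
    intervalIntegral.integral_mono_on (by linarith) (hVc.intervalIntegrable _ _) (by simp)
      fun s hs => hVle s (hT.trans hs.1)
  rw [intervalIntegral.integral_const, smul_eq_mul, add_sub_cancel_left] at i4
  linarith

/-- A primitive `J` of a vanishing function `p` converges if `p` is almost anti-periodic, in the
sense that `p s + p (s + d)` is controlled by the mass of an integrable function on
`[s, s + d]`. -/
theorem exists_tendsto_of_almost_antiperiodic_deriv {J p v : ℝ → ℂ} {d K : ℝ} (hd : 0 < d)
    (hp : Continuous p) (hJ : ∀ t, HasDerivAt J (p t) t) (hp0 : Tendsto p atTop (𝓝 0))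
    (hv : Continuous v) (hvint : IntegrableOn v (Set.Ioi 0))
    (hK : ∀ s, 0 ≤ s → ‖p s + p (s + d)‖ ≤ K * ∫ r in s..s + d, ‖v r‖) :
    ∃ c : ℂ, Tendsto J atTop (𝓝 c) := by
  have hpd : Continuous fun s => p (s + d) := hp.comp (by fun_prop)
  have hintg : IntegrableOn (fun s => p s + p (s + d)) (Set.Ioi 0) := by
    refine Integrable.mono' ((integrableOn_Ioi_integral_window hv.norm
      (fun t => norm_nonneg _) hvint.norm hd.le).const_mul K)
      (hp.add hpd).aestronglyMeasurable ?_
    filter_upwards [self_mem_ae_restrict measurableSet_Ioi] with s hs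
    exact hK s (le_of_lt hs)
  have hI := tendsto_limUnder_of_hasDerivAt_of_integrableOn_Ioi (a := 0)
    (f := fun t => J t + J (t + d))
    (fun t _ => (hJ t).add ((hJ (t + d)).comp_add_const t d)) hintg
  set c' := limUnder atTop fun t => J t + J (t + d)
  have hdiff : Tendsto (fun t => J (t + d) - J t) atTop (𝓝 0) := by
    rw [Metric.tendsto_atTop]
    intro ε hε
    obtain ⟨T, hT⟩ := Metric.tendsto_atTop.1 hp0 (ε / (2 * d)) (by positivity)
    refine ⟨T, fun t ht => ?_⟩
    have h := norm_image_sub_le_of_norm_deriv_right_le_segment (a := t) (b := t + d)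
      (C := ε / (2 * d))
      (fun s _ => (hJ s).continuousAt.continuousWithinAt)
      (fun s _ => (hJ s).hasDerivWithinAt)
      (fun s hs => by simpa using (hT s (ht.trans hs.1)).le) (t + d) ⟨by linarith, le_rfl⟩
    rw [dist_zero_right]
    have h2 : ε / (2 * d) * (t + d - t) = ε / 2 := by field_simp; ring
    linarith
  refine ⟨(c' - 0) / 2, ((hI.sub hdiff).div_const 2).congr fun t => ?_⟩
  ring

theorem tendsto_div_of_damped {Z q : ℝ → ℂ} {ν : ℝ} {c : ℂ} (hν : 0 < ν)
    (hZ : ∀ t, HasDerivAt Z (q t - ν * Z t) t) (hq : Tendsto q atTop (𝓝 c)) :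
    Tendsto Z atTop (𝓝 (c / ν)) := by
  have hνc : (ν : ℂ) ≠ 0 := Complex.ofReal_ne_zero.2 hν.ne'
  rw [tendsto_iff_norm_sub_tendsto_zero]
  rw [Metric.tendsto_atTop]
  intro ε hε
  obtain ⟨T, hT⟩ := Metric.tendsto_atTop.1 hq (ε * ν / 2) (by positivity)
  set F : ℝ → ℂ := fun t => (rexp (ν * t) : ℂ) * (Z t - c / ν) with hF
  have hexp : ∀ t : ℝ, HasDerivAt (fun t => rexp (ν * t)) (rexp (ν * t) * ν) t := fun t => by
    have := ((hasDerivAt_id t).const_mul ν).exp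
    simpa using this
  have hF' : ∀ t, HasDerivAt F ((rexp (ν * t) : ℂ) * (q t - c)) t := by
    intro t
    have h := (hexp t).ofReal_comp.mul ((hZ t).sub_const (c / ν))
    refine h.congr_deriv ?_
    push_cast
    field_simp
    ring
  have hbound : ∀ t, T ≤ t → ‖F t‖ ≤ ‖F T‖ + ε / 2 * rexp (ν * t) := by
    intro t ht
    refine image_norm_le_of_norm_deriv_right_le_deriv_boundary (a := T) (b := t)
      (fun s _ => (hF' s).continuousAt.continuousWithinAt)
      (fun s _ => (hF' s).hasDerivWithinAt)
      (B := fun s => ‖F T‖ + ε / 2 * rexp (ν * s))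
      (B' := fun s => ε / 2 * (rexp (ν * s) * ν))
      (by have := Real.exp_pos (ν * T); simp only [le_add_iff_nonneg_right]; positivity)
      (fun s => ((hexp s).const_mul _).const_add _) (fun s hs => ?_) ⟨ht, le_rfl⟩
    rw [norm_mul, Complex.norm_real, Real.norm_of_nonneg (Real.exp_pos _).le]
    have h1 := (hT s hs.1).le
    rw [dist_eq_norm] at h1
    calc _ ≤ rexp (ν * s) * (ε * ν / 2) := mul_le_mul_of_nonneg_left h1 (Real.exp_pos _).le
      _ = _ := by ring
  have hsmall : Tendsto (fun t => ‖F T‖ * rexp (-(ν * t))) atTop (𝓝 0) := by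
    have h1 : Tendsto (fun t : ℝ => rexp (-(ν * t))) atTop (𝓝 0) :=
      Real.tendsto_exp_neg_atTop_nhds_zero.comp (tendsto_id.const_mul_atTop hν)
    simpa using h1.const_mul ‖F T‖
  obtain ⟨T', hT'⟩ := Metric.tendsto_atTop.1 hsmall (ε / 2) (by positivity)
  refine ⟨max T T', fun t ht => ?_⟩
  have h1 := hbound t ((le_max_left _ _).trans ht)
  have h2 := hT' t ((le_max_right _ _).trans ht)
  rw [dist_zero_right, Real.norm_of_nonneg (by positivity)] at h2
  rw [dist_zero_right, norm_norm]
  have h3 : ‖F t‖ = rexp (ν * t) * ‖Z t - c / ν‖ := by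
    rw [hF, norm_mul, Complex.norm_real, Real.norm_of_nonneg (Real.exp_pos _).le]
  have hee : rexp (ν * t) * rexp (-(ν * t)) = 1 := by rw [← Real.exp_add]; simp
  have h4 : ‖Z t - c / ν‖ = ‖F t‖ * rexp (-(ν * t)) := by
    rw [h3, mul_right_comm, hee, one_mul]
  have h5 := mul_le_mul_of_nonneg_right h1 (Real.exp_pos (-(ν * t))).le
  rw [← h4, add_mul, mul_assoc, hee, mul_one] at h5
  linarith

theorem hasDerivAt_cexp_rotation (ω t : ℝ) :
    HasDerivAt (fun t : ℝ => Complex.exp (Complex.I * ω * t))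
      (Complex.I * ω * Complex.exp (Complex.I * ω * t)) t := by
  have h := (((hasDerivAt_id t).ofReal_comp).const_mul (Complex.I * ω)).cexp
  refine h.congr_deriv ?_
  push_cast
  simp only [id]
  ring

/-- A damped particle forced by a rotating vector whose amplitude is Lipschitz along a curve of
finite length converges to a uniform circular motion. -/
theorem exists_circular_asymptotics {X X1 X2 ψ w v : ℝ → ℂ} {ν ω K : ℝ} {ψlim : ℂ}
    (hν : 0 < ν) (hω : ω ≠ 0) (hK : 0 ≤ K)
    (hX : ∀ t, HasDerivAt X (X1 t) t) (hX1 : ∀ t, HasDerivAt X1 (X2 t) t) (hX2 : Continuous X2)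
    (heq : ∀ t, 0 ≤ t → X2 t + ν * X1 t = Complex.exp (Complex.I * ω * t) * ψ t)
    (hψ : Tendsto ψ atTop (𝓝 ψlim))
    (hψw : ∀ s t, 0 ≤ s → 0 ≤ t → ‖ψ t - ψ s‖ ≤ K * ‖w t - w s‖)
    (hv : Continuous v) (hw' : ∀ t, 0 ≤ t → HasDerivAt w (v t) t)
    (hvint : IntegrableOn v (Set.Ioi 0)) :
    ∃ A c : ℂ, Tendsto (fun t : ℝ => X t - (A * Complex.exp (Complex.I * ω * t) + c))
      atTop (𝓝 0) := by
  have hωc : Complex.I * ω ≠ 0 := mul_ne_zero Complex.I_ne_zero (Complex.ofReal_ne_zero.2 hω)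
  have hνω : (ν : ℂ) + Complex.I * ω ≠ 0 := by
    intro h
    have := congrArg Complex.re h
    simp at this
    exact hν.ne' this
  have hnexp : ∀ t : ℝ, ‖Complex.exp (Complex.I * ω * t)‖ = 1 := by
    intro t
    have : Complex.I * ω * t = ((ω * t : ℝ) : ℂ) * Complex.I := by push_cast; ring
    rw [this, Complex.norm_exp_ofReal_mul_I]
  set e : ℝ → ℂ := fun t => Complex.exp (Complex.I * ω * t) with he
  have hec : Continuous e := by fun_prop
  have hX1c : Continuous X1 := continuous_iff_continuousAt.2 fun t => (hX1 t).continuousAt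
  set p : ℝ → ℂ := fun t => X2 t + ν * X1 t - ψlim * e t with hp
  set J : ℝ → ℂ := fun t => X1 t + ν * X t - ψlim / (Complex.I * ω) * e t with hJ
  have hpc : Continuous p := by fun_prop
  have hJ' : ∀ t, HasDerivAt J (p t) t := by
    intro t
    have h := ((hX1 t).add ((hX t).const_mul (ν : ℂ))).sub
      ((hasDerivAt_cexp_rotation ω t).const_mul (ψlim / (Complex.I * ω)))
    refine h.congr_deriv ?_
    simp only [hp, he]
    rw [← mul_assoc (ψlim / (Complex.I * ω)), div_mul_cancel₀ _ hωc]
  have hpξ : ∀ t, 0 ≤ t → p t = e t * (ψ t - ψlim) := by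
    intro t ht
    simp only [hp]
    rw [heq t ht]
    ring
  have hp0 : Tendsto p atTop (𝓝 0) := by
    have h1 : Tendsto (fun t => ‖ψ t - ψlim‖) atTop (𝓝 0) :=
      tendsto_iff_norm_sub_tendsto_zero.1 hψ
    refine squeeze_zero_norm' ?_ h1
    filter_upwards [eventually_ge_atTop 0] with t ht
    rw [hpξ t ht, norm_mul, hnexp, one_mul]
  set d := π / |ω| with hd
  have hd0 : 0 < d := div_pos Real.pi_pos (abs_pos.2 hω)
  have hanti : ∀ t, e (t + d) = -e t := by
    intro t
    simp only [he]
    have h1 : Complex.I * ω * ((t + d : ℝ) : ℂ) =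
        Complex.I * ω * t + ((ω / |ω| : ℝ) : ℂ) * (π * Complex.I) := by
      rw [hd]; push_cast; ring
    have h2 : Complex.exp (((ω / |ω| : ℝ) : ℂ) * (π * Complex.I)) = -1 := by
      rcases lt_or_gt_of_ne hω with h | h
      · rw [abs_of_neg h, div_neg, div_self h.ne]
        push_cast
        rw [neg_one_mul, Complex.exp_neg, Complex.exp_pi_mul_I]
        norm_num
      · rw [abs_of_pos h, div_self h.ne']
        push_cast
        rw [one_mul, Complex.exp_pi_mul_I]
    rw [h1, Complex.exp_add, h2]
    ring
  obtain ⟨c, hc⟩ := exists_tendsto_of_almost_antiperiodic_deriv (K := K) hd0 hpc hJ' hp0 hv hvint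
    (fun s hs => by
      have hsd : 0 ≤ s + d := by linarith
      rw [hpξ s hs, hpξ (s + d) hsd, hanti]
      have h1 : e s * (ψ s - ψlim) + -e s * (ψ (s + d) - ψlim) =
          e s * -(ψ (s + d) - ψ s) := by ring
      rw [h1, norm_mul, hnexp, one_mul, norm_neg]
      exact (hψw s (s + d) hs hsd).trans (mul_le_mul_of_nonneg_left
        (norm_sub_le_integral_norm hv hw' hs (by linarith)) hK))
  set A := ψlim / (Complex.I * ω * (ν + Complex.I * ω)) with hA
  have hZ : ∀ t, HasDerivAt (fun t => X t - A * e t) (J t - ν * (X t - A * e t)) t := by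
    intro t
    have h := (hX t).sub ((hasDerivAt_cexp_rotation ω t).const_mul A)
    refine h.congr_deriv ?_
    have hA' : ψlim / (Complex.I * ω) = A * (ν + Complex.I * ω) := by
      rw [hA]
      field_simp
    simp only [hJ, hA', he]
    ring
  refine ⟨A, c / ν, ?_⟩
  have h := (tendsto_div_of_damped hν hZ hc).sub_const (c / ν)
  rw [sub_self] at h
  exact h.congr fun t => by simp only [he]; ring

theorem exists_forall_lt_integral_of_not_integrableOn {g : ℝ → ℝ}
    (hg : ContinuousOn g (Set.Ioi 0)) (hg0 : ∀ r, 0 < r → 0 ≤ g r) {b : ℝ} (hb : 0 < b)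
    (hdiv : ¬ IntegrableOn g (Set.Ioc 0 b)) (B : ℝ) :
    ∃ r₁, 0 < r₁ ∧ r₁ ≤ b ∧ ∀ r, 0 < r → r ≤ r₁ → B < ∫ s in r..b, g s := by
  by_contra! hcon
  have hii : ∀ {r r'}, 0 < r → r ≤ r' → IntervalIntegrable g volume r r' := by
    intro r r' hr hrr'
    refine ContinuousOn.intervalIntegrable (hg.mono fun s hs => ?_)
    rw [Set.uIcc_of_le hrr'] at hs
    exact hr.trans_le hs.1
  have hbound : ∀ r, 0 < r → r ≤ b → ∫ s in r..b, g s ≤ B := by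
    intro r hr hrb
    obtain ⟨r', hr', hr'r, hB⟩ := hcon r hr hrb
    refine le_trans ?_ hB
    rw [← integral_add_adjacent_intervals (hii hr' hr'r) (hii hr hrb)]
    have : 0 ≤ ∫ s in r'..r, g s :=
      intervalIntegral.integral_nonneg hr'r fun s hs => hg0 s (hr'.trans_le hs.1)
    linarith
  refine hdiv (integrableOn_Ioc_of_intervalIntegral_norm_bounded_left (I := B) (l := atTop)
    (a := fun n : ℕ => b * (1 / ((n : ℝ) + 1))) (fun n => ?_) ?_ (Eventually.of_forall fun n => ?_))
  · have hn : 0 < b * (1 / ((n : ℝ) + 1)) := by positivity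
    have hnb : b * (1 / ((n : ℝ) + 1)) ≤ b := by
      refine mul_le_of_le_one_right hb.le ?_
      rw [div_le_one (by positivity)]
      linarith [(Nat.cast_nonneg n : (0 : ℝ) ≤ n)]
    exact (hii hn hnb).1
  · simpa using tendsto_one_div_add_atTop_nhds_zero_nat.const_mul b
  · have hn : 0 < b * (1 / ((n : ℝ) + 1)) := by positivity
    have hnb : b * (1 / ((n : ℝ) + 1)) ≤ b := by
      refine mul_le_of_le_one_right hb.le ?_
      rw [div_le_one (by positivity)]
      linarith [(Nat.cast_nonneg n : (0 : ℝ) ≤ n)]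
    refine le_trans (le_of_eq ?_) (hbound _ hn hnb)
    rw [intervalIntegral.integral_of_le hnb]
    refine setIntegral_congr_fun measurableSet_Ioc fun s hs => ?_
    exact Real.norm_of_nonneg (hg0 s (hn.trans hs.1))

theorem exists_forall_lt_integral_of_eventually_ge {g : ℝ → ℝ} (hg : ContinuousOn g (Set.Ioi 0))
    {a c : ℝ} (ha : 0 < a) (hc : 0 < c) (hgc : ∀ᶠ r in atTop, c ≤ g r) (B : ℝ) :
    ∃ r₂, ∀ r, r₂ ≤ r → B < ∫ s in a..r, g s := by
  have hii : ∀ {r r'}, 0 < r → r ≤ r' → IntervalIntegrable g volume r r' := by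
    intro r r' hr hrr'
    refine ContinuousOn.intervalIntegrable (hg.mono fun s hs => ?_)
    rw [Set.uIcc_of_le hrr'] at hs
    exact hr.trans_le hs.1
  obtain ⟨R, hR⟩ := eventually_atTop.1 (hgc.and (eventually_ge_atTop a))
  have haR : a ≤ R := (hR R le_rfl).2
  have hRpos : 0 < R := ha.trans_le haR
  obtain ⟨r₂, hr₂⟩ := eventually_atTop.1
    (((tendsto_id.atTop_mul_const hc).eventually_gt_atTop
      (B - (∫ s in a..R, g s) + R * c)).and (eventually_ge_atTop R))
  refine ⟨r₂, fun r hr => ?_⟩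
  obtain ⟨h1, h2⟩ := hr₂ r hr
  rw [← integral_add_adjacent_intervals (hii ha haR) (hii hRpos h2)]
  have h3 : ∫ _ in R..r, c ≤ ∫ s in R..r, g s :=
    intervalIntegral.integral_mono_on h2 (by simp) (hii hRpos h2) fun s hs => (hR s hs.1).1
  simp only [intervalIntegral.integral_const, smul_eq_mul, id] at h3 h1
  linarith

section Planar

open Complex (I)

/-- The plane as the complex line. -/
def planeToComplex : EuclideanSpace ℝ (Fin 2) ≃ₗᵢ[ℝ] ℂ := Complex.orthonormalBasisOneI.repr.symm

theorem planeToComplex_apply (x : EuclideanSpace ℝ (Fin 2)) :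
    planeToComplex x = x 0 + x 1 * I := by
  simp [planeToComplex]

theorem planeToComplex_perp (x : EuclideanSpace ℝ (Fin 2)) :
    planeToComplex (perp x) = I * planeToComplex x := by
  simp only [planeToComplex_apply, perp]
  simp
  linear_combination (-(x 1 : ℂ)) * Complex.I_sq

theorem planeToComplex_circVec (r θ : ℝ) :
    planeToComplex (circVec r θ) = r * Complex.exp (I * θ) := by
  simp only [planeToComplex_apply, circVec]
  simp [mul_comm I, Complex.exp_mul_I]
  ring

theorem exists_phase (z : ℂ) : ∃ φ : ℝ, 0 ≤ φ ∧ φ < 2 * π ∧ z = ‖z‖ * Complex.exp (I * φ) := by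
  refine ⟨toIcoMod Real.two_pi_pos 0 z.arg, ?_, ?_, ?_⟩
  · exact (toIcoMod_mem_Ico Real.two_pi_pos 0 z.arg).1
  · simpa using (toIcoMod_mem_Ico Real.two_pi_pos 0 z.arg).2
  · conv_lhs => rw [← Complex.norm_mul_exp_arg_mul_I z]
    congr 1
    rw [toIcoMod, mul_comm I, Complex.exp_eq_exp_iff_exists_int]
    refine ⟨toIcoDiv Real.two_pi_pos 0 z.arg, ?_⟩
    push_cast
    simp
    ring

theorem planeToComplex_circVec_phase {z : ℂ} {φ : ℝ} (hφ : z = ‖z‖ * Complex.exp (I * φ))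
    (ω t : ℝ) :
    planeToComplex (circVec ‖z‖ (ω * t + φ)) = z * Complex.exp (I * ω * t) := by
  rw [planeToComplex_circVec]
  conv_rhs => rw [hφ]
  rw [mul_assoc, ← Complex.exp_add]
  push_cast
  ring_nf

theorem tendsto_zero_of_planeToComplex {x : ℝ → EuclideanSpace ℝ (Fin 2)}
    (h : Tendsto (fun t => planeToComplex (x t)) atTop (𝓝 0)) : Tendsto x atTop (𝓝 0) := by
  rw [tendsto_zero_iff_norm_tendsto_zero] at h ⊢
  simpa using h

theorem hasDerivAt_planeToComplex {x : ℝ → EuclideanSpace ℝ (Fin 2)} {t : ℝ}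
    (hx : DifferentiableAt ℝ x t) :
    HasDerivAt (fun s => planeToComplex (x s)) (planeToComplex (deriv x t)) t :=
  (planeToComplex.toContinuousLinearEquiv :
    EuclideanSpace ℝ (Fin 2) →L[ℝ] ℂ).hasFDerivAt.comp_hasDerivAt
    t hx.hasDerivAt

end Planar

theorem LocallyLipschitzOn.continuousOn_id_mul {g : ℝ → ℝ} {s : Set ℝ}
    (hg : LocallyLipschitzOn s g) : ContinuousOn (fun r => r * g r) s :=
  continuousOn_id.mul hg.continuousOn

theorem driving_potential_coercive {fd fe : ℝ → ℝ} {rp γm c : ℝ} (hrp : 0 < rp)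
    (hfd_lip : LocallyLipschitzOn (Set.Ioi (0 : ℝ)) fd)
    (hfe_lip : LocallyLipschitzOn (Set.Ioi (0 : ℝ)) fe)
    (hfd_bdd : ∃ C : ℝ, ∀ r : ℝ, 0 < r → fd r ≤ C)
    (hfd_lim : Tendsto fd atTop (𝓝 γm))
    (hfe_nonneg : ∀ r : ℝ, 0 < r → 0 ≤ fe r)
    (hfe_div : ¬ IntegrableOn (fun r => r * fe r) (Set.Ioc 0 rp))
    (hfe_lim : Tendsto fe atTop (𝓝 0)) (hc0 : 0 ≤ c) (hc : c < γm) :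
    (∀ B, ∃ r₁, 0 < r₁ ∧ ∀ r, 0 < r → r ≤ r₁ →
      B < ∫ s in rp..r, s * (fd s - fe s - c)) ∧
    ∀ B, ∃ r₂, ∀ r, r₂ ≤ r → B < ∫ s in rp..r, s * (fd s - fe s - c) := by
  have hcd := hfd_lip.continuousOn_id_mul
  have hce := hfe_lip.continuousOn_id_mul
  have hcont : ContinuousOn (fun s => s * (fd s - fe s - c)) (Set.Ioi 0) :=
    continuousOn_id.mul ((hfd_lip.continuousOn.sub hfe_lip.continuousOn).sub continuousOn_const)
  refine ⟨fun B => ?_, ?_⟩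
  · obtain ⟨C, hC⟩ := hfd_bdd
    obtain ⟨r₁, hr₁, hr₁p, hB⟩ := exists_forall_lt_integral_of_not_integrableOn hce
      (fun r hr => mul_nonneg hr.le (hfe_nonneg r hr)) hrp hfe_div (B + rp * (rp * |C|))
    refine ⟨r₁, hr₁, fun r hr hrr₁ => ?_⟩
    have hrrp : r ≤ rp := hrr₁.trans hr₁p
    have hsub : Set.uIcc r rp ⊆ Set.Ioi (0 : ℝ) := fun s hs => by
      rw [Set.uIcc_of_le hrrp] at hs
      exact hr.trans_le hs.1
    have hI := (hcont.mono hsub).intervalIntegrable (μ := volume)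
    have hIe := (hce.mono hsub).intervalIntegrable (μ := volume)
    have hmono : ∫ s in r..rp, s * (fd s - fe s - c) ≤
        ∫ s in r..rp, (rp * |C| - s * fe s) := by
      refine intervalIntegral.integral_mono_on hrrp hI (intervalIntegrable_const.sub hIe)
        fun s hs => ?_
      have hs0 : 0 < s := hr.trans_le hs.1
      have h1 : s * fd s ≤ rp * |C| :=
        (mul_le_mul_of_nonneg_left ((hC s hs0).trans (le_abs_self C)) hs0.le).trans
          (mul_le_mul_of_nonneg_right hs.2 (abs_nonneg C))
      nlinarith [mul_nonneg hs0.le hc0]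
    rw [intervalIntegral.integral_sub intervalIntegrable_const hIe,
      intervalIntegral.integral_const, smul_eq_mul] at hmono
    have h2 : (rp - r) * (rp * |C|) ≤ rp * (rp * |C|) :=
      mul_le_mul_of_nonneg_right (by linarith) (by positivity)
    rw [intervalIntegral.integral_symm]
    linarith [hB r hr hrr₁]
  · have hpos : 0 < (γm - c) / 2 := by linarith
    refine exists_forall_lt_integral_of_eventually_ge hcont hrp hpos ?_
    have hlim : Tendsto (fun s => fd s - fe s - c) atTop (𝓝 (γm - 0 - c)) :=
      (hfd_lim.sub hfe_lim).sub_const c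
    filter_upwards [hlim.eventually (eventually_gt_nhds (b := (γm - c) / 2) (by linarith)),
      eventually_ge_atTop 1] with s hs hs1
    nlinarith

theorem rotating_circumvention_asymptotics {fd fe : ℝ → ℝ} {rp γm ν ω : ℝ} (hrp : 0 < rp)
    (hfd_lip : LocallyLipschitzOn (Set.Ioi (0 : ℝ)) fd)
    (hfe_lip : LocallyLipschitzOn (Set.Ioi (0 : ℝ)) fe)
    (hfd_bdd : ∃ C : ℝ, ∀ r : ℝ, 0 < r → fd r ≤ C)
    (hfd_lim : Tendsto fd atTop (𝓝 γm))
    (hfe_nonneg : ∀ r : ℝ, 0 < r → 0 ≤ fe r)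
    (hfe_div : ¬ IntegrableOn (fun r => r * fe r) (Set.Ioc 0 rp))
    (hfe_lim : Tendsto fe atTop (𝓝 0)) (hν : 0 < ν) (hω : ω ≠ 0) (hωγ : ω ^ 2 < γm)
    {D D1 D2 E E1 E2 : ℝ → ℂ}
    (hD : ∀ t, HasDerivAt D (D1 t) t) (hD1 : ∀ t, HasDerivAt D1 (D2 t) t)
    (hE : ∀ t, HasDerivAt E (E1 t) t) (hE1 : ∀ t, HasDerivAt E1 (E2 t) t)
    (hE2 : Continuous E2)
    (hDeq : ∀ t, 0 ≤ t → D2 t = -(fd ‖D t - E t‖ : ℂ) * (D t - E t)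
      + ν * ω * (Complex.I * (D t - E t)) - ν * D1 t)
    (hEeq : ∀ t, 0 ≤ t → E2 t = -(fe ‖D t - E t‖ : ℂ) * (D t - E t) - ν * E1 t)
    (hne : ∀ t, 0 ≤ t → D t ≠ E t) :
    ∃ W : ℂ, W ≠ 0 ∧ fd ‖W‖ - fe ‖W‖ = ω ^ 2 ∧
      Tendsto (fun t : ℝ => D t - E t - W * Complex.exp (Complex.I * ω * t)) atTop (𝓝 0) ∧
      ∃ A c : ℂ, Tendsto (fun t : ℝ => E t - (A * Complex.exp (Complex.I * ω * t) + c))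
        atTop (𝓝 0) := by
  set h : ℝ → ℝ := fun r => fd r - fe r - ω ^ 2 with hh_def
  set e : ℝ → ℂ := fun t => Complex.exp (Complex.I * ω * t) with he
  set e' : ℝ → ℂ := fun t => Complex.exp (Complex.I * ((-ω : ℝ) : ℂ) * t) with he'
  have hee' : ∀ t, e t * e' t = 1 := by
    intro t
    simp only [he, he', ← Complex.exp_add]
    rw [← Complex.exp_zero]
    congr 1
    push_cast
    ring
  have hne' : ∀ t, ‖e' t‖ = 1 := by
    intro t
    have : Complex.I * ((-ω : ℝ) : ℂ) * t = ((-ω * t : ℝ) : ℂ) * Complex.I := by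
      push_cast
      ring
    simp only [he', this, Complex.norm_exp_ofReal_mul_I]
  have hn : ∀ t, ‖e t‖ = 1 := by
    intro t
    have := congrArg norm (hee' t)
    rwa [norm_mul, hne', mul_one, norm_one] at this
  set w : ℝ → ℂ := fun t => e' t * (D t - E t) with hw
  set v : ℝ → ℂ := fun t => e' t * (D1 t - E1 t - Complex.I * ω * (D t - E t)) with hv
  have hwn : ∀ t, ‖w t‖ = ‖D t - E t‖ := by
    intro t
    simp only [hw, norm_mul, hne', one_mul]
  have hwd : ∀ t, HasDerivAt w (v t) t := by
    intro t
    refine ((hasDerivAt_cexp_rotation (-ω) t).mul ((hD t).sub (hE t))).congr_deriv ?_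
    simp only [hv, he', Pi.sub_apply]
    push_cast
    ring
  have hvd : ∀ t, HasDerivAt v
      (e' t * (D2 t - E2 t - Complex.I * ω * (D1 t - E1 t)
        - Complex.I * ω * (D1 t - E1 t - Complex.I * ω * (D t - E t)))) t := by
    intro t
    refine ((hasDerivAt_cexp_rotation (-ω) t).mul (((hD1 t).sub (hE1 t)).sub
      (((hD t).sub (hE t)).const_mul (Complex.I * ω)))).congr_deriv ?_
    simp only [he', Pi.sub_apply]
    push_cast
    ring
  have hvc : Continuous v := continuous_iff_continuousAt.2 fun t => (hvd t).continuousAt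
  have hv' : ∀ t, 0 ≤ t → HasDerivAt v
      (-(((ν : ℂ) + 2 * ω * Complex.I) * v t) - (h ‖w t‖ : ℂ) * w t) t := by
    intro t ht
    convert hvd t using 1
    rw [hDeq t ht, hEeq t ht, hwn]
    simp only [hv, hw, hh_def]
    push_cast
    linear_combination (e' t * ω ^ 2 * (D t - E t)) * Complex.I_sq
  have hh : LocallyLipschitzOn (Set.Ioi (0 : ℝ)) h := by
    have h1 := (hfd_lip.sub hfe_lip).sub (LocallyLipschitz.const (ω ^ 2)).locallyLipschitzOn
    exact h1
  obtain ⟨hG0, hG1⟩ := driving_potential_coercive hrp hfd_lip hfe_lip hfd_bdd hfd_lim hfe_nonneg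
    hfe_div hfe_lim (sq_nonneg ω) hωγ
  obtain ⟨hvint, ⟨r₁, r₂, hr₁, hr₁₂, hmem⟩, W, hW0, hhW, hWlim⟩ :=
    damped_radial_flow_converges hh hrp hG0 hG1 (by simpa using hν) hvc (fun t _ => hwd t) hv'
      fun t ht => by
        rw [← norm_ne_zero_iff, hwn, norm_ne_zero_iff]
        exact sub_ne_zero.2 (hne t ht)
  obtain ⟨K, hK, hKlip⟩ := exists_lipschitz_radial hfe_lip hr₁ hr₁₂
  have hψ : Tendsto (fun t => -((fe ‖w t‖ : ℂ) * w t)) atTop (𝓝 (-((fe ‖W‖ : ℂ) * W))) := by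
    have hcont : ContinuousAt fe ‖W‖ :=
      hfe_lip.continuousOn.continuousAt (Ioi_mem_nhds (norm_pos_iff.2 hW0))
    exact (((Complex.continuous_ofReal.tendsto _).comp (hcont.tendsto.comp hWlim.norm)).mul
      hWlim).neg
  obtain ⟨A, c, hAc⟩ := exists_circular_asymptotics hν hω hK hE hE1 hE2
    (ψ := fun t => -((fe ‖w t‖ : ℂ) * w t)) (w := w) (v := v)
    (fun t ht => by
      rw [hEeq t ht, hwn]
      simp only [hw]
      linear_combination ((fe ‖D t - E t‖ : ℂ) * (D t - E t)) * hee' t) hψ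
    (fun s t hs ht => by
      rw [neg_sub_neg, norm_sub_rev]
      exact hKlip _ _ (hmem t ht) (hmem s hs)) hvc (fun t _ => hwd t) hvint
  refine ⟨W, hW0, by simpa [hh_def, sub_eq_zero] using hhW, ?_, A, c, hAc⟩
  have hW' : Tendsto (fun t => ‖w t - W‖) atTop (𝓝 0) := tendsto_iff_norm_sub_tendsto_zero.1 hWlim
  rw [tendsto_zero_iff_norm_tendsto_zero]
  refine hW'.congr fun t => ?_
  rw [← one_mul ‖w t - W‖, ← hn t, ← norm_mul]
  congr 1
  simp only [hw]
  linear_combination hee' t * (D t - E t)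

/-- In the circumvention mode (`κᵖ ≡ 1`, `κᶜ ≡ κᶜ ≠ 0`, `|κᶜ| < ν √γ_m`),
`|u(t)|` converges to the radius `r_c` with `f(r_c) = (κᶜ/ν)²`, the relative position
converges to a rotating vector of angular velocity `κᶜ/ν`, and driver and evader converge
to rotational motion about a common center. -/
theorem circumvention_mode_convergence_to_rotational_motion
    (fd fe : ℝ → ℝ) (rp γm : ℝ) (hrp : 0 < rp) (hγm : 0 < γm)
    (hfd_lip : LocallyLipschitzOn (Set.Ioi (0:ℝ)) fd)
    (hfe_lip : LocallyLipschitzOn (Set.Ioi (0:ℝ)) fe)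
    (hf_neg : ∀ r : ℝ, 0 < r → r < rp → fd r - fe r < 0)
    (hf_nonneg : ∀ r : ℝ, rp ≤ r → 0 ≤ fd r - fe r)
    (hf_deriv : 0 < deriv (fun r => fd r - fe r) rp)
    (hfd_nonneg : ∀ r : ℝ, 0 < r → 0 ≤ fd r)
    (hfd_bdd : ∃ C : ℝ, ∀ r : ℝ, 0 < r → fd r ≤ C)
    (hfd_lim : Filter.Tendsto fd Filter.atTop (nhds γm))
    (hfe_nonneg : ∀ r : ℝ, 0 < r → 0 ≤ fe r)
    (hfe_div : ¬ MeasureTheory.IntegrableOn (fun r => r * fe r) (Set.Ioc 0 rp))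
    (hfe_lim : Filter.Tendsto fe Filter.atTop (nhds 0))
    (ν : ℝ) (hν : 0 < ν) (κc : ℝ) (hκc0 : κc ≠ 0) (hκc : |κc| < ν * Real.sqrt γm)
    (ud ue : ℝ → EuclideanSpace ℝ (Fin 2))
    (hud : ContDiff ℝ 2 ud) (hue : ContDiff ℝ 2 ue)
    (hsol : ∀ t : ℝ, 0 ≤ t → SolvesSys fd fe ν (fun _ => 1) (fun _ => κc) ud ue t)
    (h0 : ud 0 ≠ ue 0) (hne : ∀ t : ℝ, 0 ≤ t → ud t ≠ ue t) :
    ∃ rc : ℝ, 0 < rc ∧ fd rc - fe rc = (κc / ν) ^ 2 ∧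
      Filter.Tendsto (fun t => ‖ud t - ue t‖) Filter.atTop (nhds rc) ∧
      ∃ φ₁ : ℝ, 0 ≤ φ₁ ∧ φ₁ < 2 * Real.pi ∧
        Filter.Tendsto (fun t => ud t - ue t - circVec rc (κc / ν * t + φ₁))
          Filter.atTop (nhds 0) ∧
        ∃ ucstar : EuclideanSpace ℝ (Fin 2), ∃ rd re φd φe : ℝ, 0 ≤ rd ∧ 0 ≤ re ∧
          Filter.Tendsto (fun t => ud t - (circVec rd (κc / ν * t + φd) + ucstar))
            Filter.atTop (nhds 0) ∧
          Filter.Tendsto (fun t => ue t - (circVec re (κc / ν * t + φe) + ucstar))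
            Filter.atTop (nhds 0) := by
  set ω : ℝ := κc / ν with hω_def
  have hω : ω ≠ 0 := div_ne_zero hκc0 hν.ne'
  have hνω : ν * ω = κc := mul_div_cancel₀ _ hν.ne'
  have hωγ : ω ^ 2 < γm := by
    rw [← Real.sqrt_lt_sqrt_iff (sq_nonneg ω), Real.sqrt_sq_eq_abs, hω_def, abs_div,
      abs_of_pos hν, div_lt_iff₀ hν, mul_comm]
    exact hκc
  have hdiff : ∀ {x : ℝ → EuclideanSpace ℝ (Fin 2)}, ContDiff ℝ 2 x →
      Differentiable ℝ x ∧ Differentiable ℝ (deriv x) ∧ Continuous (deriv (deriv x)) := by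
    intro x hx
    have h1 : ContDiff ℝ 1 (deriv x) := (contDiff_succ_iff_deriv (n := 1)).1 hx |>.2.2
    exact ⟨hx.differentiable (by norm_num), h1.differentiable (by norm_num),
      h1.continuous_deriv le_rfl⟩
  obtain ⟨hd1, hd2, -⟩ := hdiff hud
  obtain ⟨he1, he2, he3⟩ := hdiff hue
  have hnorm : ∀ t, ‖planeToComplex (ud t) - planeToComplex (ue t)‖ = ‖ud t - ue t‖ := by
    intro t
    rw [← map_sub, LinearIsometryEquiv.norm_map]
  obtain ⟨W, hW0, hfW, hWlim, A, c, hAc⟩ := rotating_circumvention_asymptotics hrp hfd_lip hfe_lip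
    hfd_bdd hfd_lim hfe_nonneg hfe_div hfe_lim hν hω hωγ
    (fun t => hasDerivAt_planeToComplex (hd1 t)) (fun t => hasDerivAt_planeToComplex (hd2 t))
    (fun t => hasDerivAt_planeToComplex (he1 t)) (fun t => hasDerivAt_planeToComplex (he2 t))
    (planeToComplex.continuous.comp he3)
    (fun t ht => by
      rw [(hsol t ht).1, hnorm, ← Complex.ofReal_mul, hνω]
      simp only [map_sub, map_add, map_smul, planeToComplex_perp, one_mul, Complex.real_smul,
        Complex.ofReal_neg])
    (fun t ht => by
      rw [(hsol t ht).2, hnorm]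
      simp only [map_sub, map_smul, Complex.real_smul, Complex.ofReal_neg])
    (fun t ht => planeToComplex.injective.ne (hne t ht))
  obtain ⟨φ₁, hφ0, hφπ, hφ⟩ := exists_phase W
  obtain ⟨φd, -, -, hφd⟩ := exists_phase (A + W)
  obtain ⟨φe, -, -, hφe⟩ := exists_phase A
  have hrel : Tendsto (fun t => ud t - ue t - circVec ‖W‖ (ω * t + φ₁)) atTop (𝓝 0) := by
    refine tendsto_zero_of_planeToComplex (hWlim.congr fun t => ?_)
    rw [map_sub, map_sub, planeToComplex_circVec_phase hφ]
  refine ⟨‖W‖, norm_pos_iff.2 hW0, hfW, ?_, φ₁, hφ0, hφπ, hrel, planeToComplex.symm c, ‖A + W‖,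
    ‖A‖, φd, φe, norm_nonneg _, norm_nonneg _, ?_, ?_⟩
  · have hcirc : ∀ t, ‖circVec ‖W‖ (ω * t + φ₁)‖ = ‖W‖ := by
      intro t
      rw [← planeToComplex.norm_map, planeToComplex_circVec, norm_mul, mul_comm Complex.I,
        Complex.norm_exp_ofReal_mul_I, mul_one, Complex.norm_real, norm_norm]
    rw [tendsto_iff_norm_sub_tendsto_zero]
    refine squeeze_zero (fun _ => norm_nonneg _) (fun t => ?_)
      (tendsto_zero_iff_norm_tendsto_zero.1 hrel)
    have := abs_norm_sub_norm_le (ud t - ue t) (circVec ‖W‖ (ω * t + φ₁))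
    rwa [hcirc] at this
  · refine tendsto_zero_of_planeToComplex ?_
    have hsum := hWlim.add hAc
    rw [add_zero] at hsum
    refine hsum.congr fun t => ?_
    rw [map_sub, map_add, planeToComplex_circVec_phase hφd, LinearIsometryEquiv.apply_symm_apply]
    ring
  · refine tendsto_zero_of_planeToComplex (hAc.congr fun t => ?_)
    rw [map_sub, map_add, planeToComplex_circVec_phase hφe, LinearIsometryEquiv.apply_symm_apply]
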